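/- Let n be a positive integer and let f : (0,∞) → ℝ be a C² function with f(t) > 0 for all t > 0, sup_{t>0} t f'(t)/f(t) < p(n), and inf_{t>0} t² f''(t)/f(t) > −∞. Then there is no positive solution of Δu + f(u) = 0 on all of ℝⁿ. -/

import Mathlib

open Set Metric

/-- Euclidean space ℝⁿ. -/
abbrev E (n : ℕ) := EuclideanSpace ℝ (Fin n)

/-- The Laplacian of `u : ℝⁿ → ℝ`: the sum of its second partial derivatives. -/
noncomputable def lap {n : ℕ} (u : E n → ℝ) (x : E n) : ℝ :=
  ∑ i : Fin n,
    iteratedFDeriv ℝ 2 u x ![EuclideanSpace.single i 1, EuclideanSpace.single i 1]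

open scoped ContDiff Topology

/-- The partial derivative of `g` in the `i`-th coordinate direction. -/
noncomputable def pderivE {n : ℕ} (i : Fin n) (g : E n → ℝ) (x : E n) : ℝ :=
  fderiv ℝ g x (EuclideanSpace.single i 1)

/-- The squared norm of the gradient of `g`. -/
noncomputable def gradSq {n : ℕ} (g : E n → ℝ) (x : E n) : ℝ :=
  ∑ i, pderivE i g x ^ 2

section PartialDerivatives

variable {n : ℕ}

lemma ContDiff.pderivE {g : E n → ℝ} {k m : WithTop ℕ∞} (hg : ContDiff ℝ m g) (h : k + 1 ≤ m)
    (i : Fin n) : ContDiff ℝ k (pderivE i g) :=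
  (hg.fderiv_right h).clm_apply contDiff_const

lemma ContDiff.pderivE_infty {g : E n → ℝ} (hg : ContDiff ℝ ∞ g) (i : Fin n) :
    ContDiff ℝ ∞ (_root_.pderivE i g) :=
  hg.pderivE (by simp) i

lemma hasDerivAt_line {g : E n → ℝ} (i : Fin n) (x : E n) (s : ℝ)
    (hg : DifferentiableAt ℝ g (x + s • EuclideanSpace.single i 1)) :
    HasDerivAt (fun t : ℝ => g (x + t • EuclideanSpace.single i 1))
      (pderivE i g (x + s • EuclideanSpace.single i 1)) s := by
  have h1 : HasDerivAt (fun t : ℝ => x + t • (EuclideanSpace.single i 1 : E n))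
      (EuclideanSpace.single i 1) s := by
    simpa using ((hasDerivAt_id s).smul_const (EuclideanSpace.single i 1 : E n)).const_add x
  exact hg.hasFDerivAt.comp_hasDerivAt s h1

lemma pderivE_eq_of_hasDerivAt {g : E n → ℝ} {i : Fin n} {x : E n} {a : ℝ}
    (hg : DifferentiableAt ℝ g x)
    (h : HasDerivAt (fun t : ℝ => g (x + t • EuclideanSpace.single i 1)) a 0) :
    pderivE i g x = a := by
  have := hasDerivAt_line i x 0 (g := g) (by simpa using hg)
  simpa using this.unique h

lemma pderivE_pderivE {g : E n → ℝ} (hg : ContDiff ℝ 2 g) (i j : Fin n) (x : E n) :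
    pderivE i (pderivE j g) x =
      fderiv ℝ (fderiv ℝ g) x (EuclideanSpace.single i 1) (EuclideanSpace.single j 1) := by
  have h : DifferentiableAt ℝ (fderiv ℝ g) x :=
    (hg.fderiv_right (m := 1) (by norm_num)).differentiable (by norm_num) x
  have : HasFDerivAt (pderivE j g) _ x :=
    h.hasFDerivAt.clm_apply (hasFDerivAt_const (EuclideanSpace.single j (1 : ℝ)) x)
  rw [pderivE, this.fderiv]
  simp

lemma pderivE_comm {g : E n → ℝ} (hg : ContDiff ℝ 2 g) (i j : Fin n) :
    pderivE i (pderivE j g) = pderivE j (pderivE i g) := by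
  funext x
  rw [pderivE_pderivE hg, pderivE_pderivE hg]
  exact (hg.contDiffAt.isSymmSndFDerivAt (by simp)).eq _ _

lemma lap_eq_sum {g : E n → ℝ} (hg : ContDiff ℝ 2 g) (x : E n) :
    lap g x = ∑ i, pderivE i (pderivE i g) x := by
  simp [lap, iteratedFDeriv_two_apply, pderivE_pderivE hg]

lemma pderivE_add {a b : E n → ℝ} {x : E n} (i : Fin n) (ha : DifferentiableAt ℝ a x)
    (hb : DifferentiableAt ℝ b x) :
    pderivE i (fun y => a y + b y) x = pderivE i a x + pderivE i b x := by
  simp [pderivE, fderiv_fun_add ha hb]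

lemma pderivE_neg {a : E n → ℝ} {x : E n} (i : Fin n) :
    pderivE i (fun y => -a y) x = -pderivE i a x := by
  simp [pderivE, fderiv_fun_neg]

lemma pderivE_sum {ι : Type*} {s : Finset ι} {a : ι → E n → ℝ} {x : E n} (i : Fin n)
    (ha : ∀ k ∈ s, DifferentiableAt ℝ (a k) x) :
    pderivE i (fun y => ∑ k ∈ s, a k y) x = ∑ k ∈ s, pderivE i (a k) x := by
  simp [pderivE, fderiv_fun_sum ha]

lemma pderivE_mul {a b : E n → ℝ} {x : E n} (i : Fin n) (ha : DifferentiableAt ℝ a x)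
    (hb : DifferentiableAt ℝ b x) :
    pderivE i (fun y => a y * b y) x = pderivE i a x * b x + a x * pderivE i b x := by
  simp [pderivE, fderiv_fun_mul ha hb]
  ring

lemma pderivE_div {a b : E n → ℝ} {x : E n} (i : Fin n) (ha : DifferentiableAt ℝ a x)
    (hb : DifferentiableAt ℝ b x) (hx : b x ≠ 0) :
    pderivE i (fun y => a y / b y) x =
      pderivE i a x / b x - a x * pderivE i b x / b x ^ 2 := by
  have h1 := hasDerivAt_line i x 0 (g := a) (by simpa using ha)
  have h2 := hasDerivAt_line i x 0 (g := b) (by simpa using hb)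
  refine pderivE_eq_of_hasDerivAt (by fun_prop (disch := assumption)) ?_
  have h := h1.fun_div h2 (by simpa using hx)
  simp only [zero_smul, add_zero] at h
  rw [show pderivE i a x / b x - a x * pderivE i b x / b x ^ 2 =
    (pderivE i a x * b x - a x * pderivE i b x) / b x ^ 2 by field_simp]
  exact h

lemma pderivE_log {a : E n → ℝ} {x : E n} (i : Fin n) (ha : DifferentiableAt ℝ a x)
    (hx : a x ≠ 0) :
    pderivE i (fun y => Real.log (a y)) x = pderivE i a x / a x := by
  simp [pderivE, fderiv.log ha hx]
  field_simp

lemma pderivE_comp {φ : ℝ → ℝ} {a : E n → ℝ} {x : E n} (i : Fin n)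
    (hφ : DifferentiableAt ℝ φ (a x)) (ha : DifferentiableAt ℝ a x) :
    pderivE i (fun y => φ (a y)) x = deriv φ (a x) * pderivE i a x := by
  have h1 : HasFDerivAt (fun y => φ (a y)) _ x :=
    hφ.hasDerivAt.comp_hasFDerivAt x ha.hasFDerivAt
  simp [pderivE, h1.fderiv]

lemma continuous_gradSq {g : E n → ℝ} (hg : ContDiff ℝ 1 g) : Continuous (gradSq g) :=
  continuous_finsetSum _ fun i _ => (hg.pderivE (k := 0) (by simp) i).continuous.pow 2

end PartialDerivatives

section Bochner

variable {n : ℕ}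

lemma pderivE_gradSq {v : E n → ℝ} (hv : ContDiff ℝ ∞ v) (i : Fin n) (x : E n) :
    pderivE i (gradSq v) x = 2 * ∑ j, pderivE j v x * pderivE i (pderivE j v) x := by
  have hd (j : Fin n) : Differentiable ℝ (pderivE j v) :=
    (hv.pderivE_infty j).differentiable (by simp)
  have : gradSq v = fun y => ∑ j, pderivE j v y * pderivE j v y := by
    funext y; simp [gradSq, sq]
  rw [this, pderivE_sum i fun j _ => ((hd j).fun_mul (hd j)) x, Finset.mul_sum]
  refine Finset.sum_congr rfl fun j _ => ?_
  rw [pderivE_mul i (hd j x) (hd j x)]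
  ring

lemma bochner {v : E n → ℝ} (hv : ContDiff ℝ ∞ v) (x : E n) :
    ∑ i, pderivE i (pderivE i (gradSq v)) x =
      2 * ∑ i, ∑ j, pderivE i (pderivE j v) x ^ 2 +
        2 * ∑ j, pderivE j v x * pderivE j (lap v) x := by
  have h2 {g : E n → ℝ} (hg : ContDiff ℝ ∞ g) : ContDiff ℝ 2 g := contDiff_infty.1 hg 2
  have hd {g : E n → ℝ} (hg : ContDiff ℝ ∞ g) : Differentiable ℝ g := hg.differentiable (by simp)
  have hv1 (j : Fin n) := hv.pderivE_infty j
  have hv2 (i j : Fin n) := (hv1 j).pderivE_infty i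
  have hlap : lap v = fun y => ∑ i, pderivE i (pderivE i v) y := funext (lap_eq_sum (h2 hv))
  have hcomm (i j : Fin n) : pderivE i (pderivE i (pderivE j v)) =
      pderivE j (pderivE i (pderivE i v)) := by
    rw [pderivE_comm (h2 hv) i j, pderivE_comm (h2 (hv1 i)) i j]
  have hterm (i : Fin n) : pderivE i (pderivE i (gradSq v)) x =
      2 * ∑ j, (pderivE i (pderivE j v) x ^ 2 +
        pderivE j v x * pderivE j (pderivE i (pderivE i v)) x) := by
    have : pderivE i (gradSq v) =
        fun y => ∑ j, 2 * (pderivE j v y * pderivE i (pderivE j v) y) := by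
      funext y; rw [pderivE_gradSq hv, Finset.mul_sum]
    rw [this, pderivE_sum i fun j _ => ((hd (hv1 j)).fun_mul (hd (hv2 i j))).const_mul 2 x,
      Finset.mul_sum]
    refine Finset.sum_congr rfl fun j _ => ?_
    rw [pderivE_mul i (by fun_prop) (((hd (hv1 j)).fun_mul (hd (hv2 i j))) x),
      pderivE_mul i (hd (hv1 j) x) (hd (hv2 i j) x), hcomm i j]
    simp [pderivE]
    ring
  simp_rw [hterm, ← Finset.mul_sum, Finset.sum_add_distrib, mul_add]
  congr 2
  rw [Finset.sum_comm]
  refine Finset.sum_congr rfl fun j _ => ?_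
  rw [hlap, pderivE_sum j fun i _ => hd (hv2 i i) x, Finset.mul_sum]

/-- Cauchy–Schwarz for a matrix against the projection onto the complement of a vector `p`. -/
lemma sq_trace_sub_le (A : Fin n → Fin n → ℝ) (p : Fin n → ℝ) (F a : ℝ) (hF : F ≠ 0)
    (hp : ∑ i, p i ^ 2 = F) (ha : ∑ i, ∑ j, p i * p j * A i j = a * F) :
    (∑ i, A i i - a) ^ 2 ≤ ((n : ℝ) - 1) * ∑ i, ∑ j, A i j ^ 2 := by
  let B : Fin n → Fin n → ℝ := fun i j => (if i = j then 1 else 0) - p i * p j / F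
  have h1 : ∑ i, ∑ j, B i j * A i j = ∑ i, A i i - a := by
    have : ∀ i j, B i j * A i j = (if i = j then A i j else 0) - p i * p j * A i j / F := by
      intro i j; simp only [B]; split_ifs <;> ring
    simp_rw [this, Finset.sum_sub_distrib, ← Finset.sum_div, ha]
    simp [hF]
  have h2 : ∑ i, ∑ j, B i j ^ 2 = (n : ℝ) - 1 := by
    have : ∀ i j, B i j ^ 2 =
        (if i = j then 1 - 2 * p i ^ 2 / F else 0) + p i ^ 2 * p j ^ 2 / F ^ 2 := by
      intro i j; simp only [B]; split_ifs with h
      · subst h; field_simp; ring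
      · ring
    simp_rw [this, Finset.sum_add_distrib, ← Finset.sum_div, ← Finset.mul_sum, hp,
      ← Finset.sum_mul, hp]
    simp [Finset.sum_sub_distrib, ← Finset.sum_div, ← Finset.mul_sum, hp]
    field_simp
    ring
  have := Finset.sum_mul_sq_le_sq_mul_sq (Finset.univ ×ˢ Finset.univ)
    (fun z : Fin n × Fin n => B z.1 z.2) (fun z => A z.1 z.2)
  simp only [Finset.sum_product] at this
  rwa [h1, h2] at this

end Bochner

section SecondDerivativeTest

lemma second_deriv_nonpos_of_isLocalMax {g g' : ℝ → ℝ} {g'' : ℝ}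
    (hmax : IsLocalMax g 0) (hg : ∀ᶠ s in 𝓝 0, HasDerivAt g (g' s) s)
    (hg' : HasDerivAt g' g'' 0) : g' 0 = 0 ∧ g'' ≤ 0 := by
  have hd : deriv g =ᶠ[𝓝 0] g' := hg.mono fun s hs => hs.deriv
  have h0 : deriv g 0 = 0 := hmax.deriv_eq_zero
  have h2 : deriv (deriv g) 0 = g'' := by rw [hd.deriv_eq, hg'.deriv]
  refine ⟨by rw [← hd.self_of_nhds, h0], ?_⟩
  by_contra! hpos
  have hmin : IsLocalMin g 0 :=
    isLocalMin_of_deriv_deriv_pos (by rw [h2]; exact hpos) h0 hg.self_of_nhds.continuousAt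
  have hconst : g =ᶠ[𝓝 0] fun _ => g 0 := by
    filter_upwards [hmax, hmin] with s h1 h2 using le_antisymm h1 h2
  have : deriv (deriv g) 0 = 0 := by
    rw [hconst.deriv.deriv_eq]; simp
  linarith

end SecondDerivativeTest

section GradientEstimate

variable {n : ℕ}

lemma sub_norm_sq_line (c x : E n) (R s : ℝ) (i : Fin n) :
    R ^ 2 - ‖x + s • EuclideanSpace.single i 1 - c‖ ^ 2 =
      R ^ 2 - ‖x - c‖ ^ 2 - 2 * (x i - c i) * s - s ^ 2 := by
  rw [add_sub_right_comm, norm_add_sq_real, inner_smul_right, EuclideanSpace.inner_single_right,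
    norm_smul]
  simp
  ring

/-- First and second order conditions at an interior maximum of
`(R ^ 2 - ‖x - c‖ ^ 2) ^ 2 * F x`. -/
lemma pderivE_of_weighted_max {F : E n → ℝ} (hF : ContDiff ℝ 2 F) {c x₀ : E n} {R q M : ℝ}
    (hR : 0 < R) (hq : R ^ 2 - ‖x₀ - c‖ ^ 2 = q) (hq0 : 0 < q) (hM : q ^ 2 * F x₀ = M)
    (hmax : ∀ x ∈ closedBall c R, (R ^ 2 - ‖x - c‖ ^ 2) ^ 2 * F x ≤ M) (i : Fin n) :
    pderivE i F x₀ = 4 * M * (x₀ i - c i) / q ^ 3 ∧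
      pderivE i (pderivE i F) x₀ ≤ M * (4 / q ^ 3 + 24 * (x₀ i - c i) ^ 2 / q ^ 4) := by
  set d := x₀ i - c i with hd
  set Q : ℝ → ℝ := fun s => q - 2 * d * s - s ^ 2 with hQ
  have hQ0 : Q 0 = q := by simp [hQ]
  have hQd (s : ℝ) : HasDerivAt Q (-2 * (d + s)) s := by
    have := (((hasDerivAt_id s).const_mul (2 * d)).const_sub q).sub ((hasDerivAt_id s).pow 2)
    exact this.congr_deriv (by simp; ring)
  have hQc : Continuous Q := by fun_prop
  have hQpos : ∀ᶠ s in 𝓝 (0 : ℝ), 0 < Q s :=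
    hQc.continuousAt.eventually (lt_mem_nhds (by rw [hQ0]; exact hq0))
  have hQn (s : ℝ) : R ^ 2 - ‖x₀ + s • EuclideanSpace.single i 1 - c‖ ^ 2 = Q s := by
    rw [sub_norm_sq_line, hq]
  have hF1 : ContDiff ℝ 1 (pderivE i F) := hF.pderivE (by norm_num) i
  have key := second_deriv_nonpos_of_isLocalMax
    (g := fun s => F (x₀ + s • EuclideanSpace.single i 1) - M / Q s ^ 2)
    (g' := fun s => pderivE i F (x₀ + s • EuclideanSpace.single i 1) - 4 * M * (d + s) / Q s ^ 3)
    (g'' := pderivE i (pderivE i F) x₀ - M * (4 / q ^ 3 + 24 * d ^ 2 / q ^ 4)) ?_ ?_ ?_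
  · simp only [zero_smul, add_zero, hQ0] at key
    exact ⟨by linarith [key.1], by linarith [key.2]⟩
  · filter_upwards [hQpos] with s hs
    have h0 : F x₀ - M / q ^ 2 = 0 := by rw [← hM]; field_simp; ring
    simp only [zero_smul, add_zero, hQ0, h0]
    rw [sub_nonpos, le_div_iff₀ (by positivity), mul_comm, ← hQn]
    refine hmax _ ?_
    rw [mem_closedBall, dist_eq_norm]
    refine abs_le_of_sq_le_sq' ?_ hR.le |>.2
    linarith [hQn s]
  · filter_upwards [hQpos] with s hs
    have h1 := hasDerivAt_line i x₀ s (hF.differentiable (by norm_num) _)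
    have h2 := (hasDerivAt_const s M).fun_div ((hQd s).fun_pow 2) (by positivity)
    refine (h1.sub h2).congr_deriv ?_
    simp
    field_simp
    ring
  · have h1 := hasDerivAt_line i x₀ 0 (hF1.differentiable (by norm_num) _)
    have h2 := (((hasDerivAt_id (0 : ℝ)).const_add d).const_mul (4 * M)).fun_div
      ((hQd 0).fun_pow 3) (by rw [hQ0]; positivity)
    refine (h1.sub h2).congr_deriv ?_
    simp [hQ0]
    field_simp
    ring

lemma quadratic_absorption {N κ σ m F h a A D β : ℝ} (hN : 0 ≤ N) (hσ : 0 < σ) (hσ1 : σ ≤ 1)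
    (hκ : N * κ = 4 * (1 - σ)) (hF : 0 ≤ F) (hh : 0 ≤ h) (htr : (F + h + a) ^ 2 ≤ N * A)
    (hB : 2 * A - 4 * a * F - 2 * (κ * h * F + D) ≤ m * (F * β)) (ha : a ^ 2 ≤ 4 * (F * β)) :
    σ / 4 * F ^ 2 ≤ (8 / σ + 16 * N ^ 2 / σ + N * m / 2) * (F * β) + N * D := by
  have e1 : (F + h + a) ^ 2 ≤
      N * (2 * a * F) + 4 * (1 - σ) * h * F + N * D + N * (m / 2) * (F * β) := by
    have := mul_le_mul_of_nonneg_left hB hN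
    linear_combination htr + this / 2 + h * F * hκ
  have e2 : 0 ≤ σ / 2 * (F + h + 2 / σ * a) ^ 2 := by positivity
  have e2' : σ / 2 * (F + h + 2 / σ * a) ^ 2 =
      σ / 2 * (F + h) ^ 2 + 2 * (F + h) * a + 2 / σ * a ^ 2 := by field_simp; ring
  have e3 : 0 ≤ σ / 4 * (F - 4 * N / σ * a) ^ 2 := by positivity
  have e3' : σ / 4 * (F - 4 * N / σ * a) ^ 2 =
      σ / 4 * F ^ 2 - 2 * N * a * F + 4 * N ^ 2 / σ * a ^ 2 := by field_simp; ring
  have e4 : 0 ≤ (1 - σ) * (F - h) ^ 2 := mul_nonneg (by linarith) (sq_nonneg _)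
  have e5 : 0 ≤ σ / 2 * (h * (2 * F + h)) := by positivity
  have e6 : (2 / σ + 4 * N ^ 2 / σ) * a ^ 2 ≤ (2 / σ + 4 * N ^ 2 / σ) * (4 * (F * β)) :=
    mul_le_mul_of_nonneg_left ha (by positivity)
  have e7 : (2 / σ + 4 * N ^ 2 / σ) * (4 * (F * β)) =
    (8 / σ + 16 * N ^ 2 / σ) * (F * β) := by ring
  nlinarith [sq_nonneg a]

/-- The logarithmic gradient estimate at a maximum point of the localised squared gradient. -/
lemma gradSq_estimate {v h : E n → ℝ} (hn : 0 < n) (hv : ContDiff ℝ ∞ v)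
    (hh : ∀ x, lap v x = -gradSq v x - h x) {c x₀ : E n} {R κ σ q M : ℝ} (hR : 0 < R)
    (hσ : 0 < σ) (hσ1 : σ ≤ 1) (hκ : ((n : ℝ) - 1) * κ = 4 * (1 - σ))
    (hx₀ : x₀ ∈ closedBall c R) (hq : R ^ 2 - ‖x₀ - c‖ ^ 2 = q) (hM : q ^ 2 * gradSq v x₀ = M)
    (hmax : ∀ x ∈ closedBall c R, (R ^ 2 - ‖x - c‖ ^ 2) ^ 2 * gradSq v x ≤ M)
    (hMpos : 0 < M) (hh0 : 0 ≤ h x₀) :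
    σ / 4 * M ^ 2 ≤
      (8 / σ + 16 * ((n : ℝ) - 1) ^ 2 / σ + ((n : ℝ) - 1) * (4 * n + 24) / 2) * R ^ 2 * M +
        ((n : ℝ) - 1) *
          (q ^ 4 * (∑ j, pderivE j v x₀ * pderivE j h x₀ - κ * h x₀ * gradSq v x₀)) := by
  have hn1 : (0 : ℝ) ≤ (n : ℝ) - 1 := by
    have : (1 : ℝ) ≤ n := by exact_mod_cast hn
    linarith
  have hr : ‖x₀ - c‖ ≤ R := by rwa [mem_closedBall, dist_eq_norm] at hx₀
  have hr2 : ‖x₀ - c‖ ^ 2 ≤ R ^ 2 := by gcongr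
  have hq0 : 0 < q := by
    rcases eq_or_lt_of_le (show 0 ≤ q by linarith) with h0 | h0
    · rw [← h0] at hM; simp at hM; linarith
    · exact h0
  have hqR : q ≤ R ^ 2 := by nlinarith [sq_nonneg ‖x₀ - c‖]
  set F := gradSq v x₀ with hF
  have hFpos : 0 < F := by
    by_contra! hneg
    nlinarith [mul_nonneg (sq_nonneg q) (neg_nonneg.2 hneg)]
  have hv1 (j : Fin n) := hv.pderivE_infty j
  have hgrad : ContDiff ℝ ∞ (gradSq v) := ContDiff.sum fun j _ => (hv1 j).pow 2
  have hlap : ContDiff ℝ ∞ (lap v) := by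
    rw [funext (lap_eq_sum (contDiff_infty.1 hv 2))]
    exact ContDiff.sum fun j _ => (hv1 j).pderivE_infty j
  have hheq : h = fun x => -lap v x + -gradSq v x := by funext x; rw [hh]; ring
  have hmaxc := pderivE_of_weighted_max (contDiff_infty.1 hgrad 2) hR hq hq0 hM hmax
  set p : Fin n → ℝ := fun j => pderivE j v x₀ with hp
  set A : Fin n → Fin n → ℝ := fun i j => pderivE i (pderivE j v) x₀ with hA
  set d : Fin n → ℝ := fun i => x₀ i - c i with hd
  have hdsum : ∑ i, d i ^ 2 = ‖x₀ - c‖ ^ 2 := by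
    rw [EuclideanSpace.real_norm_sq_eq]; simp [hd]
  have hpsum : ∑ i, p i ^ 2 = F := rfl
  set a : ℝ := 2 * (∑ i, p i * d i) / q with ha
  have hpF : ∑ i, p i * pderivE i (gradSq v) x₀ = 2 * (a * F) := by
    have : ∀ i, p i * pderivE i (gradSq v) x₀ = p i * d i * (4 * M / q ^ 3) := by
      intro i; rw [(hmaxc i).1]; ring
    simp_rw [this, ← Finset.sum_mul, ha, ← hM]
    field_simp
    ring
  have haF : ∑ i, ∑ j, p i * p j * A i j = a * F := by
    have : ∀ i, p i * pderivE i (gradSq v) x₀ = 2 * ∑ j, p i * p j * A i j := by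
      intro i
      rw [pderivE_gradSq hv, Finset.mul_sum, Finset.mul_sum, Finset.mul_sum]
      exact Finset.sum_congr rfl fun j _ => by simp only [hp, hA]; ring
    simp_rw [this, ← Finset.mul_sum] at hpF
    linarith
  have htr := sq_trace_sub_le A p F a hFpos.ne' hpsum haF
  have hAtr : ∑ i, A i i = -F - h x₀ := by
    rw [← hh, lap_eq_sum (contDiff_infty.1 hv 2)]
  have hV : ∑ j, p j * pderivE j h x₀ =
      -(∑ j, p j * pderivE j (lap v) x₀) - 2 * (a * F) := by
    rw [← hpF, ← Finset.sum_neg_distrib, ← Finset.sum_sub_distrib]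
    refine Finset.sum_congr rfl fun j _ => ?_
    have h1 : DifferentiableAt ℝ (lap v) x₀ := hlap.differentiable (by simp) x₀
    have h2 : DifferentiableAt ℝ (gradSq v) x₀ := hgrad.differentiable (by simp) x₀
    rw [hheq, pderivE_add j h1.fun_neg h2.fun_neg, pderivE_neg, pderivE_neg]
    ring
  have hB := bochner hv x₀
  have hL : ∑ i, pderivE i (pderivE i (gradSq v)) x₀ ≤ (4 * n + 24) * (F * (R ^ 2 / q ^ 2)) := by
    calc _ ≤ ∑ i, M * (4 / q ^ 3 + 24 * d i ^ 2 / q ^ 4) :=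
          Finset.sum_le_sum fun i _ => (hmaxc i).2
      _ = F * (4 * n * q + 24 * ‖x₀ - c‖ ^ 2) / q ^ 2 := by
          rw [← Finset.mul_sum, Finset.sum_add_distrib, ← Finset.sum_div, ← Finset.sum_div,
            ← Finset.mul_sum, hdsum, ← hM]
          simp
          field_simp
      _ ≤ F * (4 * n * R ^ 2 + 24 * R ^ 2) / q ^ 2 := by gcongr
      _ = _ := by ring
  have ha2 : a ^ 2 ≤ 4 * (F * (R ^ 2 / q ^ 2)) := by
    have := Finset.sum_mul_sq_le_sq_mul_sq Finset.univ p d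
    rw [hdsum, hpsum] at this
    calc a ^ 2 = 4 * (∑ i, p i * d i) ^ 2 / q ^ 2 := by rw [ha]; ring
      _ ≤ 4 * (F * ‖x₀ - c‖ ^ 2) / q ^ 2 := by gcongr
      _ ≤ 4 * (F * R ^ 2) / q ^ 2 := by gcongr
      _ = _ := by ring
  have main := quadratic_absorption (m := 4 * n + 24) (h := h x₀) (A := ∑ i, ∑ j, A i j ^ 2)
    (D := ∑ j, p j * pderivE j h x₀ - κ * h x₀ * F) (β := R ^ 2 / q ^ 2) (a := a) hn1 hσ hσ1 hκ
    hFpos.le hh0 (by rw [hAtr] at htr; linarith [htr]) (by linarith) ha2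
  have := mul_le_mul_of_nonneg_left main (show 0 ≤ q ^ 4 by positivity)
  rw [← hM]
  refine le_of_eq_of_le (by ring) (this.trans_eq ?_)
  simp only [hp]
  field_simp

end GradientEstimate

section Mollification

open MeasureTheory Filter

variable {n : ℕ}

/-- Mollification of `k` by the normalised bump function `ρ`. -/
noncomputable def mollify (ρ : ContDiffBump (0 : E n)) (k : E n → ℝ) : E n → ℝ :=
  convolution (ρ.normed volume) k (ContinuousLinearMap.lsmul ℝ ℝ) volume

lemma mollify_apply (ρ : ContDiffBump (0 : E n)) (k : E n → ℝ) (x : E n) :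
    mollify ρ k x = ∫ t, ρ.normed volume t * k (x - t) := rfl

lemma integrable_normed_mul (ρ : ContDiffBump (0 : E n)) {k : E n → ℝ} (hk : Continuous k)
    (x : E n) : Integrable fun t => ρ.normed volume t * k (x - t) :=
  (ρ.continuous_normed.mul (by fun_prop)).integrable_of_hasCompactSupport
    ρ.hasCompactSupport_normed.mul_right

lemma contDiff_mollify (ρ : ContDiffBump (0 : E n)) {k : E n → ℝ} (hk : Continuous k) :
    ContDiff ℝ ∞ (mollify ρ k) :=
  ρ.hasCompactSupport_normed.contDiff_convolution_left _ ρ.contDiff_normed hk.locallyIntegrable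

lemma mollify_pos (ρ : ContDiffBump (0 : E n)) {k : E n → ℝ} (hk : Continuous k)
    (hpos : ∀ x, 0 < k x) (x : E n) : 0 < mollify ρ k x := by
  rw [mollify_apply, integral_pos_iff_support_of_nonneg
    (fun t => mul_nonneg (ρ.nonneg_normed t) (hpos _).le) (integrable_normed_mul ρ hk x)]
  have : (Function.support fun t => ρ.normed volume t * k (x - t)) = ball 0 ρ.rOut := by
    rw [← ρ.support_normed_eq (μ := volume)]
    ext t
    simp [(hpos (x - t)).ne']
  rw [this]
  exact measure_ball_pos _ _ ρ.rOut_pos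

lemma pderivE_mollify (ρ : ContDiffBump (0 : E n)) {k : E n → ℝ} (hk : ContDiff ℝ 1 k)
    (i : Fin n) : pderivE i (mollify ρ k) = mollify ρ (pderivE i k) := by
  funext x
  have hk' : Continuous (pderivE i k) := (hk.pderivE (k := 0) (by simp) i).continuous
  refine pderivE_eq_of_hasDerivAt ((contDiff_mollify ρ hk.continuous).differentiable (by simp) x) ?_
  obtain ⟨C, hC⟩ := (isCompact_closedBall x (1 + ρ.rOut)).exists_bound_of_continuousOn
    hk'.continuousOn
  set e : E n := EuclideanSpace.single i 1 with he
  have hbound (t : E n) (s : ℝ) (hs : s ∈ ball (0 : ℝ) 1) :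
      ‖ρ.normed volume t * pderivE i k (x + s • e - t)‖ ≤ ρ.normed volume t * C := by
    rw [norm_mul, Real.norm_of_nonneg (ρ.nonneg_normed t)]
    by_cases ht : t ∈ ball (0 : E n) ρ.rOut
    · refine mul_le_mul_of_nonneg_left (hC _ ?_) (ρ.nonneg_normed t)
      rw [mem_closedBall, dist_eq_norm]
      rw [mem_ball_zero_iff] at ht hs
      calc ‖x + s • e - t - x‖ = ‖s • e - t‖ := by congr 1; abel
        _ ≤ ‖s • e‖ + ‖t‖ := norm_sub_le _ _
        _ ≤ 1 + ρ.rOut := by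
          rw [norm_smul, show ‖e‖ = 1 by simp [he], mul_one]
          exact add_le_add hs.le ht.le
    · rw [← ρ.support_normed_eq (μ := volume), Function.notMem_support] at ht
      simp [ht]
  have hderiv (t : E n) (s : ℝ) : HasDerivAt (fun s => ρ.normed volume t * k (x + s • e - t))
      (ρ.normed volume t * pderivE i k (x + s • e - t)) s := by
    have := hasDerivAt_line i (x - t) s (hk.differentiable (by simp) _)
    simp only [sub_add_eq_add_sub] at this
    exact this.const_mul _
  have hmeas : AEStronglyMeasurable
      (fun t => ρ.normed volume t * pderivE i k (x + (0 : ℝ) • e - t)) volume :=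
    (integrable_normed_mul ρ hk' _).aestronglyMeasurable
  have key := (hasDerivAt_integral_of_dominated_loc_of_deriv_le
    (F := fun s t => ρ.normed volume t * k (x + s • e - t))
    (F' := fun s t => ρ.normed volume t * pderivE i k (x + s • e - t))
    (ball_mem_nhds (0 : ℝ) one_pos)
    (Eventually.of_forall fun s =>
      (integrable_normed_mul ρ hk.continuous (x + s • e)).aestronglyMeasurable)
    (integrable_normed_mul ρ hk.continuous (x + (0 : ℝ) • e)) hmeas
    (Eventually.of_forall hbound) (ρ.integrable_normed.mul_const C)
    (Eventually.of_forall fun t s _ => hderiv t s)).2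
  simp_rw [mollify_apply]
  rw [zero_smul, add_zero] at key
  exact key

lemma lap_mollify (ρ : ContDiffBump (0 : E n)) {k : E n → ℝ} (hk : ContDiff ℝ 2 k) (x : E n) :
    lap (mollify ρ k) x = mollify ρ (lap k) x := by
  have hk1 (i : Fin n) : ContDiff ℝ 1 (pderivE i k) := hk.pderivE (by norm_num) i
  have hk2 (i : Fin n) : Continuous (pderivE i (pderivE i k)) :=
    ((hk1 i).pderivE (k := 0) (by simp) i).continuous
  rw [lap_eq_sum (contDiff_infty.1 (contDiff_mollify ρ hk.continuous) 2), mollify_apply]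
  simp_rw [lap_eq_sum hk, Finset.mul_sum]
  rw [integral_finsetSum _ fun i _ => integrable_normed_mul ρ (hk2 i) x]
  refine Finset.sum_congr rfl fun i _ => ?_
  rw [pderivE_mollify ρ (hk.of_le (by norm_num)), pderivE_mollify ρ (hk1 i), mollify_apply]

lemma tendsto_mollify {ρ : ℕ → ContDiffBump (0 : E n)}
    (hρ : Tendsto (fun m => (ρ m).rOut) atTop (𝓝 0)) {k : E n → ℝ} (hk : Continuous k)
    {y : ℕ → E n} {x : E n} (hy : Tendsto y atTop (𝓝 x)) :
    Tendsto (fun m => mollify (ρ m) k (y m)) atTop (𝓝 (k x)) :=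
  ContDiffBump.convolution_tendsto_right hρ
    (Eventually.of_forall fun _ => hk.aestronglyMeasurable)
    (hk.continuousAt.tendsto.comp tendsto_snd) hy

end Mollification

section Liouville

open Filter

variable {n : ℕ}

lemma gradSq_log {w : E n → ℝ} {x : E n} (hw : DifferentiableAt ℝ w x) (hx : w x ≠ 0) :
    gradSq (fun y => Real.log (w y)) x = ∑ i, (pderivE i w x / w x) ^ 2 := by
  simp [gradSq, pderivE_log _ hw hx]

lemma lap_log {w : E n → ℝ} (hw : ContDiff ℝ 2 w) (hpos : ∀ x, 0 < w x) (x : E n) :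
    lap (fun y => Real.log (w y)) x =
      -gradSq (fun y => Real.log (w y)) x - -lap w x / w x := by
  have hd : Differentiable ℝ w := hw.differentiable (by norm_num)
  have hd1 (i : Fin n) : Differentiable ℝ (pderivE i w) :=
    (hw.pderivE (k := 1) (by norm_num) i).differentiable (by norm_num)
  rw [lap_eq_sum (hw.log fun y => (hpos y).ne'), lap_eq_sum hw,
    gradSq_log (hd x) (hpos x).ne', neg_div, Finset.sum_div, sub_neg_eq_add,
    ← Finset.sum_neg_distrib, ← Finset.sum_add_distrib]
  refine Finset.sum_congr rfl fun i _ => ?_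
  have : pderivE i (fun y => Real.log (w y)) = fun y => pderivE i w y / w y :=
    funext fun y => pderivE_log i (hd y) (hpos y).ne'
  rw [this, pderivE_div i (hd1 i x) (hd x) (hpos x).ne']
  ring

/-- Gradient bound on balls for positive solutions of `Δu + G = 0`, where only one derivative of
`G` is available; the estimate for smooth functions is applied to mollifications of `u`. -/
lemma log_gradient_bound (hn : 0 < n) {u G : E n → ℝ} (hu : ContDiff ℝ 2 u) (hG : ContDiff ℝ 1 G)
    (hupos : ∀ x, 0 < u x) (hGpos : ∀ x, 0 < G x) (hlap : ∀ x, lap u x = -G x) {κ σ : ℝ}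
    (hσ : 0 < σ) (hσ1 : σ ≤ 1) (hκ : ((n : ℝ) - 1) * κ = 4 * (1 - σ))
    (hD : ∀ x, ∑ j, pderivE j u x / u x *
        (pderivE j G x / u x - G x * pderivE j u x / u x ^ 2) -
      κ * (G x / u x) * ∑ j, (pderivE j u x / u x) ^ 2 ≤ 0)
    {R : ℝ} (hR : 0 < R) (c : E n) :
    σ / 4 * (R ^ 4 * ∑ j, (pderivE j u c / u c) ^ 2) ≤
      (8 / σ + 16 * ((n : ℝ) - 1) ^ 2 / σ + ((n : ℝ) - 1) * (4 * n + 24) / 2) * R ^ 2 := by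
  set C := 8 / σ + 16 * ((n : ℝ) - 1) ^ 2 / σ + ((n : ℝ) - 1) * (4 * n + 24) / 2 with hC
  set P : E n → ℝ := fun x => ∑ j, (pderivE j u x / u x) ^ 2 with hP
  have hn1 : (0 : ℝ) ≤ (n : ℝ) - 1 := by
    have : (1 : ℝ) ≤ n := by exact_mod_cast hn
    linarith
  have hP0 : 0 ≤ P c := by positivity
  rcases hP0.eq_or_lt with h0 | hPc
  · rw [show ∑ j, (pderivE j u c / u c) ^ 2 = 0 from h0.symm]
    simp only [mul_zero]
    positivity
  let ρ₀ : ℕ → ContDiffBump (0 : E n) := fun m =>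
    ⟨1 / (m + 2), 1 / (m + 1), by positivity, by gcongr; norm_num⟩
  have hρ₀ : Tendsto (fun m => (ρ₀ m).rOut) atTop (𝓝 0) := tendsto_one_div_add_atTop_nhds_zero_nat
  have hu' (i : Fin n) : Continuous (pderivE i u) :=
    (hu.pderivE (k := 1) (by norm_num) i).continuous
  have hG' (i : Fin n) : Continuous (pderivE i G) := (hG.pderivE (k := 0) (by simp) i).continuous
  have hw (ρ : ContDiffBump (0 : E n)) := contDiff_mollify ρ hu.continuous
  have hwpos (ρ : ContDiffBump (0 : E n)) := mollify_pos ρ hu.continuous hupos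
  let v : ContDiffBump (0 : E n) → E n → ℝ := fun ρ y => Real.log (mollify ρ u y)
  have hv (ρ : ContDiffBump (0 : E n)) : ContDiff ℝ ∞ (v ρ) := (hw ρ).log fun y => (hwpos ρ y).ne'
  let h : ContDiffBump (0 : E n) → E n → ℝ := fun ρ y => mollify ρ G y / mollify ρ u y
  have hlapw (ρ : ContDiffBump (0 : E n)) (x : E n) : -lap (mollify ρ u) x = mollify ρ G x := by
    rw [lap_mollify ρ hu, funext hlap]
    simp [mollify_apply, MeasureTheory.integral_neg]
  have hvh (ρ : ContDiffBump (0 : E n)) (x : E n) : lap (v ρ) x = -gradSq (v ρ) x - h ρ x := by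
    rw [lap_log (contDiff_infty.1 (hw ρ) 2) (hwpos ρ), hlapw]
  have hdw (ρ : ContDiffBump (0 : E n)) : Differentiable ℝ (mollify ρ u) :=
    (hw ρ).differentiable (by simp)
  have hvj (ρ : ContDiffBump (0 : E n)) (x : E n) (j : Fin n) :
      pderivE j (v ρ) x = mollify ρ (pderivE j u) x / mollify ρ u x := by
    rw [pderivE_log j (hdw ρ x) (hwpos ρ x).ne', pderivE_mollify ρ (hu.of_le (by norm_num))]
  have hhj (ρ : ContDiffBump (0 : E n)) (x : E n) (j : Fin n) :
      pderivE j (h ρ) x = mollify ρ (pderivE j G) x / mollify ρ u x -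
        mollify ρ G x * mollify ρ (pderivE j u) x / mollify ρ u x ^ 2 := by
    rw [pderivE_div j ((contDiff_mollify ρ hG.continuous).differentiable (by simp) x) (hdw ρ x)
      (hwpos ρ x).ne', pderivE_mollify ρ hG, pderivE_mollify ρ (hu.of_le (by norm_num))]
  -- maximum points of the localised squared gradients
  have hexists (m : ℕ) : ∃ y ∈ closedBall c R, ∀ x ∈ closedBall c R,
      (R ^ 2 - ‖x - c‖ ^ 2) ^ 2 * gradSq (v (ρ₀ m)) x ≤
        (R ^ 2 - ‖y - c‖ ^ 2) ^ 2 * gradSq (v (ρ₀ m)) y := by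
    have hcont := continuous_gradSq ((hv (ρ₀ m)).of_le (m := 1) (by simp))
    exact (isCompact_closedBall c R).exists_isMaxOn (nonempty_closedBall.2 hR.le)
      (f := fun x => (R ^ 2 - ‖x - c‖ ^ 2) ^ 2 * gradSq (v (ρ₀ m)) x) (by fun_prop)
  choose y₀ hy₀ hmax₀ using hexists
  obtain ⟨z, -, φ, hφ, hyz⟩ := (isCompact_closedBall c R).tendsto_subseq hy₀
  set ρ : ℕ → ContDiffBump (0 : E n) := fun m => ρ₀ (φ m) with hρdef
  set y : ℕ → E n := fun m => y₀ (φ m) with hydef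
  have hρ : Tendsto (fun m => (ρ m).rOut) atTop (𝓝 0) := hρ₀.comp hφ.tendsto_atTop
  have hy : Tendsto y atTop (𝓝 z) := hyz
  have tvj {a : ℕ → E n} {b : E n} (hab : Tendsto a atTop (𝓝 b)) (j : Fin n) :
      Tendsto (fun m => pderivE j (v (ρ m)) (a m)) atTop (𝓝 (pderivE j u b / u b)) := by
    simp_rw [hvj]
    exact (tendsto_mollify hρ (hu' j) hab).div (tendsto_mollify hρ hu.continuous hab)
      (hupos b).ne'
  have tF {a : ℕ → E n} {b : E n} (hab : Tendsto a atTop (𝓝 b)) :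
      Tendsto (fun m => gradSq (v (ρ m)) (a m)) atTop (𝓝 (P b)) :=
    tendsto_finsetSum _ fun j _ => (tvj hab j).pow 2
  have tu := tendsto_mollify hρ hu.continuous hy
  have th : Tendsto (fun m => h (ρ m) (y m)) atTop (𝓝 (G z / u z)) :=
    (tendsto_mollify hρ hG.continuous hy).div tu (hupos z).ne'
  have thj (j : Fin n) : Tendsto (fun m => pderivE j (h (ρ m)) (y m)) atTop
      (𝓝 (pderivE j G z / u z - G z * pderivE j u z / u z ^ 2)) := by
    simp_rw [hhj]
    exact ((tendsto_mollify hρ (hG' j) hy).div tu (hupos z).ne').sub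
      (((tendsto_mollify hρ hG.continuous hy).mul (tendsto_mollify hρ (hu' j) hy)).div (tu.pow 2)
        (pow_pos (hupos z) 2).ne')
  have tq : Tendsto (fun m => R ^ 2 - ‖y m - c‖ ^ 2) atTop (𝓝 (R ^ 2 - ‖z - c‖ ^ 2)) :=
    (((hy.sub_const c).norm).pow 2).const_sub _
  set q := R ^ 2 - ‖z - c‖ ^ 2 with hq
  set M := q ^ 2 * P z with hM
  have tM : Tendsto (fun m => (R ^ 2 - ‖y m - c‖ ^ 2) ^ 2 * gradSq (v (ρ m)) (y m)) atTop (𝓝 M) :=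
    (tq.pow 2).mul (tF hy)
  have hMc : R ^ 4 * P c ≤ M := by
    refine le_of_tendsto_of_tendsto' ((tF (tendsto_const_nhds (x := c))).const_mul (R ^ 4)) tM
      fun m => ?_
    refine le_of_eq_of_le ?_ (hmax₀ (φ m) c (mem_closedBall_self hR.le))
    simp
    ring
  have hMpos : 0 < M := lt_of_lt_of_le (by positivity) hMc
  have tD := (tq.pow 4).mul ((tendsto_finsetSum Finset.univ fun j _ => (tvj hy j).mul (thj j)).sub
    ((th.const_mul κ).mul (tF hy)))
  have hlim := le_of_tendsto_of_tendsto ((tM.pow 2).const_mul (σ / 4))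
    ((tM.const_mul (C * R ^ 2)).add (tD.const_mul ((n : ℝ) - 1)))
    ((tM.eventually (lt_mem_nhds hMpos)).mono fun m hm =>
      gradSq_estimate hn (hv (ρ m)) (hvh (ρ m)) hR hσ hσ1 hκ (hy₀ (φ m)) rfl rfl (hmax₀ (φ m)) hm
        (div_pos (mollify_pos _ hG.continuous hGpos _) (hwpos _ _)).le)
  have hDz : ((n : ℝ) - 1) * (q ^ 4 * (∑ j, pderivE j u z / u z *
        (pderivE j G z / u z - G z * pderivE j u z / u z ^ 2) - κ * (G z / u z) * P z)) ≤ 0 :=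
    mul_nonpos_of_nonneg_of_nonpos hn1
      (mul_nonpos_of_nonneg_of_nonpos (by positivity) (hD z))
  have hfin : σ / 4 * M ≤ C * R ^ 2 := by
    refine le_of_mul_le_mul_right ?_ hMpos
    linarith
  exact (mul_le_mul_of_nonneg_left hMc (by positivity)).trans hfin

lemma eq_zero_of_forall_pow_bound {a b p : ℝ} (ha : 0 < a) (hp : 0 ≤ p)
    (h : ∀ R : ℝ, 0 < R → a * (R ^ 4 * p) ≤ b * R ^ 2) : p = 0 := by
  by_contra hne
  have hp' : 0 < p := lt_of_le_of_ne hp (Ne.symm hne)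
  have hR : 0 < (|b| + 1) / (a * p) := by positivity
  have h1 := h _ (Real.sqrt_pos.2 hR)
  rw [show √((|b| + 1) / (a * p)) ^ 4 = (√((|b| + 1) / (a * p)) ^ 2) ^ 2 by ring,
    Real.sq_sqrt hR.le] at h1
  have h2 : a * (((|b| + 1) / (a * p)) ^ 2 * p) = (|b| + 1) * ((|b| + 1) / (a * p)) := by
    field_simp
  rw [h2] at h1
  have := le_of_mul_le_mul_right h1 hR
  linarith [le_abs_self b]

end Liouville

/-- Liouville theorem: no positive global solution of `Δu + f(u) = 0` on ℝⁿ
for positive `f` with `sup t f'/f < p(n)` and `inf t² f''/f > -∞`. -/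
theorem stmt1 (n : ℕ) (hn : 0 < n) (f : ℝ → ℝ)
    (hf : ContDiffOn ℝ 2 f (Ioi 0))
    (hfpos : ∀ t : ℝ, 0 < t → 0 < f t)
    (hΛ : ∃ Λ₀ : ℝ, (1 < n → Λ₀ < ((n : ℝ) + 3) / ((n : ℝ) - 1)) ∧
      ∀ t : ℝ, 0 < t → t * deriv f t / f t ≤ Λ₀)
    (hPi : ∃ Pi₀ : ℝ, ∀ t : ℝ, 0 < t → Pi₀ ≤ t ^ 2 * deriv (deriv f) t / f t) :
    ¬ ∃ u : E n → ℝ, ContDiff ℝ 2 u ∧ (∀ x, 0 < u x) ∧ ∀ x, lap u x + f (u x) = 0 := by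
  rintro ⟨u, hu, hupos, heq⟩
  obtain ⟨Λ₀, hΛn, hΛ⟩ := hΛ
  have hn1 : (1 : ℝ) ≤ n := by exact_mod_cast hn
  obtain ⟨κ, hκΛ, hκ0, hκn⟩ : ∃ κ : ℝ, Λ₀ ≤ 1 + κ ∧ 0 ≤ κ ∧ ((n : ℝ) - 1) * κ < 4 := by
    refine ⟨max (Λ₀ - 1) 0, by linarith [le_max_left (Λ₀ - 1) 0], le_max_right _ _, ?_⟩
    rcases (Nat.succ_le_of_lt hn).eq_or_lt with h1 | h1
    · simp [← h1]
    · have h1' : (0 : ℝ) < (n : ℝ) - 1 := by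
        have : (1 : ℝ) < n := by exact_mod_cast h1
        linarith
      have := (lt_div_iff₀ h1').1 (hΛn h1)
      rw [mul_max_of_nonneg _ _ h1'.le, max_lt_iff]
      constructor <;> linarith
  have hfd (t : ℝ) (ht : 0 < t) : DifferentiableAt ℝ f t :=
    (hf.differentiableOn (by norm_num)).differentiableAt (Ioi_mem_nhds ht)
  have hud : Differentiable ℝ u := hu.differentiable (by norm_num)
  have hG : ContDiff ℝ 1 (fun x => f (u x)) := contDiff_iff_contDiffAt.2 fun x =>
    ((hf.contDiffAt (Ioi_mem_nhds (hupos x))).of_le (by norm_num)).comp x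
      (hu.of_le (by norm_num)).contDiffAt
  have hbound {R : ℝ} (hR : 0 < R) (c : E n) :=
    log_gradient_bound hn hu hG hupos (fun x => hfpos _ (hupos x))
      (fun x => by linarith [heq x]) (κ := κ) (σ := 1 - (n - 1) * κ / 4) (by linarith)
      (by nlinarith [mul_nonneg (sub_nonneg.2 hn1) hκ0]) (by ring)
      (fun x => by
        have hx := hupos x
        have hfx := hfpos _ hx
        have hΛx : u x * deriv f (u x) ≤ (1 + κ) * f (u x) :=
          (div_le_iff₀ hfx).1 ((hΛ _ hx).trans hκΛ)
        have hterm (j : Fin n) : pderivE j u x / u x *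
            (pderivE j (fun x => f (u x)) x / u x - f (u x) * pderivE j u x / u x ^ 2) =
            (pderivE j u x / u x) ^ 2 * (deriv f (u x) - f (u x) / u x) := by
          rw [pderivE_comp j (hfd _ hx) (hud x)]
          field_simp
        simp_rw [hterm, ← Finset.sum_mul]
        rw [show ∀ S : ℝ, S * (deriv f (u x) - f (u x) / u x) - κ * (f (u x) / u x) * S =
          S * ((u x * deriv f (u x) - (1 + κ) * f (u x)) / u x) by intro S; field_simp; ring]
        exact mul_nonpos_of_nonneg_of_nonpos (by positivity)
          (div_nonpos_of_nonpos_of_nonneg (by linarith) hx.le)) hR c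
  have hgrad (j : Fin n) : pderivE j u = fun _ => 0 := by
    funext c
    have h0 := eq_zero_of_forall_pow_bound (by linarith)
      (Finset.sum_nonneg fun j _ => sq_nonneg _) fun R hR => hbound hR c
    have := (Finset.sum_eq_zero_iff_of_nonneg fun j _ => sq_nonneg _).1 h0 j (Finset.mem_univ j)
    simpa [(hupos c).ne'] using this
  have hlap0 : lap u 0 = 0 := by
    simp [lap_eq_sum hu, hgrad, pderivE]
  linarith [heq 0, hfpos _ (hupos 0)]
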